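/- arXiv:1802.08828 — 2 statements merged into one kernel-verified Lean document; each statement's English description precedes it below -/
import Mathlib

section
/- Let c : Fin n → ℤ, let j : Fin n with c j ≠ 0, and let z ∈ ℂ^n satisfy z j = 0 and z i ≠ 0 for all i ≠ j. Then the stabilizer of z in T'_c equals the intersection T'_c ∩ G_j, and this group is a finite cyclic group of order |c j|. -/
open scoped BigOperators

noncomputable def torusChar {n : ℕ} (c : Fin n → ℤ) : (Fin n → Circle) →* Circle where
  toFun t := ∏ i, t i ^ c i
  map_one' := by simp
  map_mul' a b := by simp [mul_zpow, Finset.prod_mul_distrib]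

noncomputable def torusKer {n : ℕ} (c : Fin n → ℤ) : Subgroup (Fin n → Circle) :=
  (torusChar c).ker

/-- The `j`-th coordinate circle subgroup `G_j ⊆ T^n`. -/
noncomputable def coordCircle {n : ℕ} (j : Fin n) : Subgroup (Fin n → Circle) where
  carrier := {t | ∀ i, i ≠ j → t i = 1}
  one_mem' := fun i _ => rfl
  mul_mem' := by
    intro a b ha hb i hi
    show a i * b i = 1
    rw [ha i hi, hb i hi, one_mul]
  inv_mem' := by
    intro a ha i hi
    show (a i)⁻¹ = 1
    rw [ha i hi, inv_one]

lemma torusChar_mulSingle {n : ℕ} (c : Fin n → ℤ) (j : Fin n) (u : Circle) :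
    torusChar c (Pi.mulSingle j u) = u ^ c j := by
  change ∏ i, (Pi.mulSingle j u : Fin n → Circle) i ^ c i = u ^ c j
  rw [Finset.prod_eq_single j (fun i _ hi => by simp [Pi.mulSingle_eq_of_ne hi]) (by simp),
    Pi.mulSingle_eq_same]

lemma mem_coordCircle_iff_exists_mulSingle {n : ℕ} {j : Fin n} {t : Fin n → Circle} :
    t ∈ coordCircle j ↔ ∃ u : Circle, Pi.mulSingle j u = t := by
  constructor
  · intro ht
    refine ⟨t j, funext fun i => ?_⟩
    rcases eq_or_ne i j with rfl | hi
    · simp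
    · rw [Pi.mulSingle_eq_of_ne hi, ht i hi]
  · rintro ⟨u, rfl⟩ i hi
    exact Pi.mulSingle_eq_of_ne (M := fun _ => Circle) hi u

/-- The `j`-th coordinate embedding of the units of `Circle` into the torus. -/
noncomputable def coordEmbedding {n : ℕ} (j : Fin n) : Circleˣ →* (Fin n → Circle) :=
  (MonoidHom.mulSingle (fun _ : Fin n => Circle) j).comp (Units.coeHom Circle)

lemma coordEmbedding_injective {n : ℕ} (j : Fin n) : Function.Injective (coordEmbedding j) :=
  (Pi.mulSingle_injective j).comp Units.val_injective

lemma map_rootsOfUnity_coordEmbedding {n : ℕ} (c : Fin n → ℤ) (j : Fin n) :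
    (rootsOfUnity (c j).natAbs Circle).map (coordEmbedding j) = torusKer c ⊓ coordCircle j := by
  ext t
  rw [Subgroup.mem_inf, mem_coordCircle_iff_exists_mulSingle, Subgroup.mem_map]
  constructor
  · rintro ⟨u, hu, rfl⟩
    refine ⟨?_, u, rfl⟩
    change torusChar c (Pi.mulSingle j (u : Circle)) = 1
    rw [torusChar_mulSingle, ← pow_natAbs_eq_one]
    exact (mem_rootsOfUnity' _ _).mp hu
  · rintro ⟨ht, u, rfl⟩
    refine ⟨toUnits u, (mem_rootsOfUnity' _ _).mpr ?_, rfl⟩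
    change torusChar c (Pi.mulSingle j u) = 1 at ht
    rw [torusChar_mulSingle, ← pow_natAbs_eq_one] at ht
    exact ht

lemma smul_eq_self_iff_mem_coordCircle {n : ℕ} {j : Fin n} {z : Fin n → ℂ}
    (hzj : z j = 0) (hz : ∀ i, i ≠ j → z i ≠ 0) (t : Fin n → Circle) :
    t • z = z ↔ t ∈ coordCircle j := by
  constructor
  · intro h i hi
    have hti : (t i : ℂ) * z i = z i := congrFun h i
    exact Circle.ext (by simpa [hz i hi] using hti)
  · intro h
    funext i
    change (t i : ℂ) * z i = z i
    rcases eq_or_ne i j with rfl | hi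
    · simp [hzj]
    · simp [h i hi]

/-- if `z j = 0` and all other coordinates are nonzero, the stabilizer
of `z` in `T'_c` is `T'_c ∩ G_j`, a finite cyclic group of order `|c j|`. -/
theorem stabilizer_eq_inter_coordCircle_and_cyclic
    (n : ℕ) (c : Fin n → ℤ) (j : Fin n) (hcj : c j ≠ 0)
    (z : Fin n → ℂ) (hzj : z j = 0) (hz : ∀ i, i ≠ j → z i ≠ 0) :
    (MulAction.stabilizer ↥(torusKer c) z).map (torusKer c).subtype
        = torusKer c ⊓ coordCircle j ∧
      Finite ↥(torusKer c ⊓ coordCircle j) ∧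
      IsCyclic ↥(torusKer c ⊓ coordCircle j) ∧
      Nat.card ↥(torusKer c ⊓ coordCircle j) = (c j).natAbs := by
  have : NeZero (c j).natAbs := ⟨Int.natAbs_ne_zero.mpr hcj⟩
  let e : rootsOfUnity (c j).natAbs Circle ≃* ↥(torusKer c ⊓ coordCircle j) :=
    (Subgroup.equivMapOfInjective _ _ (coordEmbedding_injective j)).trans
      (MulEquiv.subgroupCongr (map_rootsOfUnity_coordEmbedding c j))
  have hcard : Nat.card ↥(torusKer c ⊓ coordCircle j) = (c j).natAbs := by
    rw [← Nat.card_congr e.toEquiv, HasEnoughRootsOfUnity.natCard_rootsOfUnity]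
  refine ⟨?_, Nat.finite_of_card_ne_zero (hcard ▸ NeZero.ne _),
    e.isCyclic.mp (HasEnoughRootsOfUnity.cyc), hcard⟩
  ext t
  simp only [Subgroup.mem_map, Subgroup.mem_inf, MulAction.mem_stabilizer_iff,
    ← smul_eq_self_iff_mem_coordCircle hzj hz]
  constructor
  · rintro ⟨s, hs, rfl⟩
    exact ⟨s.2, hs⟩
  · rintro ⟨ht, hs⟩
    exact ⟨⟨t, ht⟩, hs, rfl⟩
end

section
/- Let c : Fin n → ℤ with c ≠ 0, and let z ∈ ℂ^n satisfy z i ≠ 0 for every i. Then the orbit space (T^n • z) / T'_c — the quotient of the T^n-orbit of z (with its subspace topology from ℂ^n) by the orbit equivalence relation of the restricted T'_c-action — is homeomorphic to Circle. -/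
open scoped BigOperators

theorem Circle.exists_zpow_eq {k : ℤ} (hk : k ≠ 0) (w : Circle) : ∃ s : Circle, s ^ k = w := by
  refine ⟨Circle.exp (Complex.arg w / k), ?_⟩
  have hk' : (k : ℝ) ≠ 0 := Int.cast_ne_zero.mpr hk
  rw [← Circle.exp_zsmul, zsmul_eq_mul, mul_div_cancel₀ _ hk', Circle.exp_arg]

theorem torusChar_surjective {n : ℕ} {c : Fin n → ℤ} (hc : c ≠ 0) :
    Function.Surjective (torusChar c) := by
  obtain ⟨i, hi⟩ := Function.ne_iff.mp hc
  intro w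
  obtain ⟨s, hs⟩ := Circle.exists_zpow_eq hi w
  refine ⟨Pi.mulSingle i s, ?_⟩
  change ∏ j, (Pi.mulSingle i s : Fin n → Circle) j ^ c j = w
  rw [Finset.prod_eq_single i (fun j _ hj => by rw [Pi.mulSingle_eq_of_ne hj, one_zpow])
    (fun h => absurd (Finset.mem_univ i) h), Pi.mulSingle_eq_same, hs]

theorem continuous_torusChar {n : ℕ} (c : Fin n → ℤ) : Continuous (torusChar c) := by
  change Continuous fun t : Fin n → Circle => ∏ i, t i ^ c i
  fun_prop

theorem isQuotientMap_torusChar {n : ℕ} {c : Fin n → ℤ} (hc : c ≠ 0) :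
    Topology.IsQuotientMap (torusChar c) :=
  (continuous_torusChar c).isClosedMap.isQuotientMap (continuous_torusChar c)
    (torusChar_surjective hc)

/-- A compact group acting continuously on a Hausdorff space maps onto each of its orbits by a
quotient map. -/
theorem isQuotientMap_smul_orbit {G X : Type*} [Group G] [TopologicalSpace G] [CompactSpace G]
    [TopologicalSpace X] [T2Space X] [MulAction G X] [ContinuousSMul G X] (x : X) :
    Topology.IsQuotientMap
      (fun g : G => (⟨g • x, MulAction.mem_orbit x g⟩ : MulAction.orbit G x)) := by
  have hcont : Continuous
      (fun g : G => (⟨g • x, MulAction.mem_orbit x g⟩ : MulAction.orbit G x)) :=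
    (continuous_id.smul continuous_const).subtype_mk _
  refine hcont.isClosedMap.isQuotientMap hcont ?_
  rintro ⟨_, g, rfl⟩
  exact ⟨g, rfl⟩

/-- The torus acts freely on points with nonzero coordinates. -/
theorem torus_smul_left_injective {n : ℕ} {z : Fin n → ℂ} (hz : ∀ i, z i ≠ 0) :
    Function.Injective (fun t : Fin n → Circle => t • z) := by
  intro s t h
  funext i
  have hi : (s i : ℂ) * z i = t i * z i := congrFun h i
  exact Circle.ext (mul_right_cancel₀ (hz i) hi)

theorem orbitRel_torusKer_smul_iff {n : ℕ} {c : Fin n → ℤ} {z : Fin n → ℂ} (hz : ∀ i, z i ≠ 0)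
    (s t : Fin n → Circle) :
    MulAction.orbitRel (torusKer c) (Fin n → ℂ) (s • z) (t • z) ↔
      torusChar c s = torusChar c t := by
  rw [MulAction.orbitRel_apply]
  constructor
  · rintro ⟨⟨u, hu⟩, h⟩
    have h' : (u * t) • z = s • z := (mul_smul u t z).trans h
    rw [← torus_smul_left_injective hz h', map_mul, MonoidHom.mem_ker.mp hu, one_mul]
  · intro h
    refine ⟨⟨s * t⁻¹, MonoidHom.mem_ker.mpr ?_⟩, ?_⟩
    · rw [map_mul, map_inv, h, mul_inv_cancel]
    · change (s * t⁻¹) • t • z = s • z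
      rw [← mul_smul, inv_mul_cancel_right]

/-- for `z` with all coordinates nonzero and `c ≠ 0`, the quotient of the
`T^n`-orbit of `z` (with its subspace topology) by the orbit equivalence relation of the
restricted `T'_c`-action is homeomorphic to the circle. -/
theorem orbit_mod_torusKer_homeomorph_circle
    (n : ℕ) (c : Fin n → ℤ) (hc : c ≠ 0) (z : Fin n → ℂ) (hz : ∀ i, z i ≠ 0) :
    Nonempty (Quotient (Setoid.comap
        ((↑) : (MulAction.orbit (Fin n → Circle) z) → (Fin n → ℂ))
        (MulAction.orbitRel ↥(torusKer c) (Fin n → ℂ))) ≃ₜ Circle) := by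
  have hq := (isQuotientMap_quotient_mk' (s := Setoid.comap
      ((↑) : (MulAction.orbit (Fin n → Circle) z) → (Fin n → ℂ))
      (MulAction.orbitRel ↥(torusKer c) (Fin n → ℂ)))).comp (isQuotientMap_smul_orbit z)
  have hχ := isQuotientMap_torusChar hc
  exact ⟨(Topology.IsQuotientMap.homeomorph (f := ⟨_, hq.continuous⟩) hq).symm.trans
    ((Homeomorph.Quotient.congrRight fun s t =>
        (Quotient.eq (r := Setoid.comap Subtype.val _) (x := ⟨_, MulAction.mem_orbit z s⟩)
          (y := ⟨_, MulAction.mem_orbit z t⟩)).trans (orbitRel_torusKer_smul_iff hz s t)).trans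
      (Topology.IsQuotientMap.homeomorph (f := ⟨_, hχ.continuous⟩) hχ))⟩
end
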